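/- Let μ be an absolutely continuous probability measure on S¹ and let ν, ν₁, ν₂, … be probability measures on S¹ with W₂(ν_n, ν) → 0 as n → ∞. For each n let T̃_n be a lift of an optimal transport map from μ to ν_n (i.e. T̃_n : ℝ → ℝ is monotone nondecreasing, satisfies T̃_n(x+2π) = T̃_n(x)+2π and ∫₀^{2π}(T̃_n(u)−u)du = 0, and exp_c ∘ T̃_n ∘ log_c is an optimal transport map from μ to ν_n), and similarly let T̃ be such a lift for ν. Then ∫₀^{2π} (T̃_n(x) − T̃(x))² dμ̃(x) → 0 as n → ∞; that is, the logarithmic map log_μ is sequentially continuous. -/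

import Mathlib

open MeasureTheory Real Set Filter Topology

noncomputable section

instance : Fact (0 < 2 * Real.pi) := ⟨by positivity⟩

/-- The circle `ℝ / 2πℤ`. -/
abbrev S1 : Type := AddCircle (2 * Real.pi)

/-- The quotient projection `exp_c : ℝ → S¹`. -/
def expc (x : ℝ) : S1 := (x : S1)

/-- The canonical right inverse `log_c : S¹ → [0, 2π)`. -/
def logc (z : S1) : ℝ := (AddCircle.equivIco (2 * Real.pi) 0 z : ℝ)

/-- Squared 2-Wasserstein distance: infimum of `∫ d(x,y)² dγ` over couplings `γ`. -/
def W2sq {X : Type*} [MeasurableSpace X] [PseudoMetricSpace X]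
    (μ ν : Measure X) : ℝ :=
  sInf { c : ℝ | ∃ γ : Measure (X × X), IsProbabilityMeasure γ ∧
      γ.map Prod.fst = μ ∧ γ.map Prod.snd = ν ∧
      c = ∫ p, dist p.1 p.2 ^ 2 ∂γ }

/-- `T` is an optimal transport map from `μ` to `ν`. -/
def IsOTM (μ ν : Measure S1) (T : S1 → S1) : Prop :=
  Measurable T ∧ μ.map T = ν ∧ (∫ z, dist z (T z) ^ 2 ∂μ) = W2sq μ ν

/-- `μ̃`, the pushforward of a measure on `S¹` to `[0, 2π) ⊆ ℝ` via `log_c`. -/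
def tilde (μ : Measure S1) : Measure ℝ := μ.map logc

/-- The periodic cumulative distribution function of a (periodicised) measure on `[0,2π)`:
`F(x) = μ̃([0,x))` for `x ∈ [0,2π]`, extended by `F(x + 2π) = F(x) + 1`. -/
def cdf (μt : Measure ℝ) (x : ℝ) : ℝ :=
  ⌊x / (2 * π)⌋ + (μt (Set.Ico 0 (Int.fract (x / (2 * π)) * (2 * π)))).toReal

/-- The quantile function (generalized inverse) of the periodic cdf. -/
def qf (μt : Measure ℝ) (u : ℝ) : ℝ := sInf { x : ℝ | u ≤ cdf μt x }

/-- The cost `C_{[μ,ν]}(θ) = ∫₀¹ (F_μ̃⁻(u) − F_ν̃⁻(u−θ))² du`. -/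
def cost (μ ν : Measure S1) (θ : ℝ) : ℝ :=
  ∫ u in (0:ℝ)..1, (qf (tilde μ) u - qf (tilde ν) (u - θ)) ^ 2


/-- `T̃ : ℝ → ℝ` is a lift of an optimal transport map from `μ` to `ν`: it is monotone
nondecreasing, `2π`-periodic-equivariant, has zero average displacement over one period,
and `exp_c ∘ T̃ ∘ log_c` is an optimal transport map from `μ` to `ν`. -/
def IsOTMLift (μ ν : Measure S1) (T : ℝ → ℝ) : Prop :=
  Monotone T ∧ (∀ x : ℝ, T (x + 2 * π) = T x + 2 * π) ∧
    (∫ u in (0:ℝ)..(2 * π), (T u - u)) = 0 ∧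
    IsOTM μ ν (fun z => expc (T (logc z)))


theorem abs_sub_le_pi_of_monotone_of_integral_eq_zero {T : ℝ → ℝ} (hT : Monotone T)
    (hper : ∀ x, T (x + 2 * π) = T x + 2 * π)
    (hint : (∫ u in (0 : ℝ)..(2 * π), (T u - u)) = 0) (x : ℝ) : |T x - x| ≤ π := by
  have hp : Function.Periodic (fun u => T u - u) (2 * π) := fun u => by
    simp only [hper]; ring
  have hI : ∀ a b : ℝ, IntervalIntegrable (fun u => T u - u) volume a b := fun a b =>
    (hT.intervalIntegrable).sub intervalIntegral.intervalIntegrable_id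
  have hzero : ∀ a : ℝ, ∫ u in a..(a + 2 * π), (T u - u) = 0 := fun a => by
    rw [hp.intervalIntegral_add_eq a 0, zero_add, hint]
  have hconst : ∀ a : ℝ, ∫ u in a..(a + 2 * π), (T x - u) = 2 * π * (T x - a - π) := fun a => by
    rw [intervalIntegral.integral_sub (by simp) intervalIntegral.intervalIntegrable_id]
    simp
    ring
  have hC : ∀ a b : ℝ, IntervalIntegrable (fun u => T x - u) volume a b := fun a b =>
    (by simp : IntervalIntegrable (fun _ => T x) volume a b).sub
      intervalIntegral.intervalIntegrable_id
  have h2 : 0 < 2 * π := by positivity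
  have hup : 2 * π * (T x - x - π) ≤ 0 := by
    rw [← hconst x, ← hzero x]
    refine intervalIntegral.integral_mono_on (by linarith) (hC _ _) (hI _ _) fun u hu => ?_
    linarith [hT hu.1]
  have hlo : 0 ≤ 2 * π * (T x - (x - 2 * π) - π) := by
    rw [← hconst (x - 2 * π), ← hzero (x - 2 * π)]
    refine intervalIntegral.integral_mono_on (by linarith) (hI _ _) (hC _ _) fun u hu => ?_
    have : u ≤ x := by linarith [hu.2]
    linarith [hT this]
  rw [abs_le]
  constructor
  · nlinarith [(mul_nonneg_iff_of_pos_left h2).1 hlo]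
  · by_contra hcon
    nlinarith [mul_pos h2 (by linarith : 0 < T x - x - π)]

theorem measurable_expc : Measurable expc := AddCircle.measurable_mk'

theorem measurable_logc : Measurable logc :=
  measurable_subtype_coe.comp (AddCircle.measurableEquivIco (2 * π) 0).measurable

theorem expc_logc (z : S1) : expc (logc z) = z :=
  (AddCircle.equivIco (2 * π) 0).symm_apply_apply z

theorem logc_mem (z : S1) : logc z ∈ Ico 0 (2 * π) := by
  simpa [logc] using (AddCircle.equivIco (2 * π) 0 z).2

theorem dist_expc_of_abs_sub_le {x y : ℝ} (h : |y - x| ≤ π) : dist (expc x) (expc y) = |x - y| := by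
  rw [dist_eq_norm, expc, expc, ← AddCircle.coe_sub,
    AddCircle.norm_coe_eq_abs_iff _ (by positivity), abs_sub_comm, abs_of_pos Real.two_pi_pos]
  linarith

theorem dist_expc_le (x y : ℝ) : dist (expc x) (expc y) ≤ |x - y| := by
  rw [dist_eq_norm, expc, expc, ← AddCircle.coe_sub]
  exact QuotientAddGroup.norm_mk_le_norm

theorem S1.dist_le_pi (x y : S1) : dist x y ≤ π := by
  rw [dist_eq_norm]
  refine (AddCircle.norm_le_half_period (2 * π) (by positivity)).trans ?_
  rw [abs_of_pos (by positivity)]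
  linarith

theorem tilde_map_expc (μ : Measure S1) : (tilde μ).map expc = μ := by
  rw [tilde, Measure.map_map measurable_expc measurable_logc]
  simp [Function.comp_def, expc_logc]

theorem ae_tilde_mem_Ico (μ : Measure S1) : ∀ᵐ x ∂(tilde μ), x ∈ Ico 0 (2 * π) :=
  (ae_map_iff measurable_logc.aemeasurable measurableSet_Ico).2 (ae_of_all _ logc_mem)

theorem tilde_singleton {μ : Measure S1} (hac : μ ≪ volume) (x : ℝ) : tilde μ {x} = 0 := by
  rw [tilde, Measure.map_apply measurable_logc (measurableSet_singleton x)]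
  refine measure_mono_null (t := {expc x}) (fun z hz => ?_) (hac ?_)
  · rw [mem_preimage, mem_singleton_iff] at hz
    rw [mem_singleton_iff, ← hz, expc_logc]
  · rw [← Metric.closedBall_zero, AddCircle.volume_closedBall]
    simp [Real.pi_pos.le]

theorem integrable_dist_S1 {Ω : Type*} [MeasurableSpace Ω] (P : Measure Ω) [IsFiniteMeasure P]
    {f g : Ω → S1} (hf : Measurable f) (hg : Measurable g) :
    Integrable (fun ω => dist (f ω) (g ω)) P :=
  Integrable.of_bound (hf.dist hg).aestronglyMeasurable π
    (ae_of_all _ fun ω => by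
      rw [Real.norm_of_nonneg dist_nonneg]; exact S1.dist_le_pi _ _)

theorem integrable_dist_sq_S1 {Ω : Type*} [MeasurableSpace Ω] (P : Measure Ω) [IsFiniteMeasure P]
    {f g : Ω → S1} (hf : Measurable f) (hg : Measurable g) :
    Integrable (fun ω => dist (f ω) (g ω) ^ 2) P :=
  Integrable.of_bound ((hf.dist hg).pow_const 2).aestronglyMeasurable (π ^ 2)
    (ae_of_all _ fun ω => by
      rw [Real.norm_of_nonneg (by positivity)]
      gcongr
      exact S1.dist_le_pi _ _)

theorem W2sq_le_integral {X : Type*} [MeasurableSpace X] [PseudoMetricSpace X] {μ ν : Measure X}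
    {γ : Measure (X × X)} [IsProbabilityMeasure γ] (h1 : γ.map Prod.fst = μ)
    (h2 : γ.map Prod.snd = ν) : W2sq μ ν ≤ ∫ p, dist p.1 p.2 ^ 2 ∂γ := by
  refine csInf_le ⟨0, ?_⟩ ⟨γ, inferInstance, h1, h2, rfl⟩
  rintro c ⟨γ', -, -, -, rfl⟩
  positivity

theorem le_W2sq {X : Type*} [MeasurableSpace X] [PseudoMetricSpace X] {μ ν : Measure X}
    [IsProbabilityMeasure μ] [IsProbabilityMeasure ν] {c : ℝ}
    (h : ∀ γ : Measure (X × X), IsProbabilityMeasure γ → γ.map Prod.fst = μ →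
      γ.map Prod.snd = ν → c ≤ ∫ p, dist p.1 p.2 ^ 2 ∂γ) : c ≤ W2sq μ ν := by
  refine le_csInf ⟨_, μ.prod ν, inferInstance, ?_, ?_, rfl⟩ ?_
  · simp [Measure.map_fst_prod]
  · simp [Measure.map_snd_prod]
  · rintro _ ⟨γ, hγ, h1, h2, rfl⟩
    exact h γ hγ h1 h2

theorem W2sq_nonneg {X : Type*} [MeasurableSpace X] [PseudoMetricSpace X] (μ ν : Measure X) :
    0 ≤ W2sq μ ν := by
  refine Real.sInf_nonneg ?_
  rintro _ ⟨γ, -, -, -, rfl⟩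
  positivity

/-- Gluing a coupling `γ` of `μ, ρ` with a coupling `η` of `ρ, σ`. -/
theorem exists_gluing {X : Type*} [MeasurableSpace X] [StandardBorelSpace X] [Nonempty X]
    (γ η : Measure (X × X)) [IsProbabilityMeasure γ] [IsProbabilityMeasure η]
    (h : γ.map Prod.snd = η.map Prod.fst) :
    ∃ P : Measure ((X × X) × X), IsProbabilityMeasure P ∧ P.map Prod.fst = γ ∧
      P.map (fun p => (p.1.2, p.2)) = η := by
  let κ : ProbabilityTheory.Kernel (X × X) X := η.condKernel.comap Prod.snd measurable_snd
  refine ⟨γ.compProd κ, inferInstance, Measure.fst_compProd γ κ, ?_⟩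
  have hm : Measurable fun p : (X × X) × X => (p.1.2, p.2) := by fun_prop
  conv_rhs => rw [← η.disintegrate η.condKernel]
  ext s hs
  rw [Measure.map_apply hm hs, Measure.compProd_apply (hm hs), Measure.compProd_apply hs,
    Measure.fst, ← h, lintegral_map (ProbabilityTheory.Kernel.measurable_kernel_prodMk_left hs)
      measurable_snd]
  rfl

theorem W2sq_le_add_of_coupling {μ ρ σ : Measure S1} (γ η : Measure (S1 × S1))
    [IsProbabilityMeasure γ] [IsProbabilityMeasure η]
    (h1 : γ.map Prod.fst = μ) (h2 : γ.map Prod.snd = ρ) (h3 : η.map Prod.fst = ρ)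
    (h4 : η.map Prod.snd = σ) :
    W2sq μ σ ≤ (∫ p, dist p.1 p.2 ^ 2 ∂γ) + 2 * π * ∫ p, dist p.1 p.2 ∂η := by
  obtain ⟨P, hP, rfl, rfl⟩ := exists_gluing γ η (h2.trans h3.symm)
  have hm : Measurable fun p : (S1 × S1) × S1 => (p.1.2, p.2) := by fun_prop
  have hm' : Measurable fun p : (S1 × S1) × S1 => (p.1.1, p.2) := by fun_prop
  have hd : Measurable fun p : S1 × S1 => dist p.1 p.2 := measurable_fst.dist measurable_snd
  have : IsProbabilityMeasure (P.map fun p => (p.1.1, p.2)) :=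
    Measure.isProbabilityMeasure_map hm'.aemeasurable
  refine (W2sq_le_integral (γ := P.map fun p => (p.1.1, p.2)) ?_ ?_).trans ?_
  · rw [← h1, Measure.map_map measurable_fst hm', Measure.map_map measurable_fst measurable_fst]
    rfl
  · rw [← h4, Measure.map_map measurable_snd hm', Measure.map_map measurable_snd hm]
    rfl
  · rw [integral_map hm'.aemeasurable (hd.pow_const 2).aestronglyMeasurable,
      integral_map measurable_fst.aemeasurable (hd.pow_const 2).aestronglyMeasurable,
      integral_map hm.aemeasurable hd.aestronglyMeasurable, ← integral_const_mul, ← integral_add]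
    · refine integral_mono (integrable_dist_sq_S1 P (by fun_prop) (by fun_prop))
        ((integrable_dist_sq_S1 P (by fun_prop) (by fun_prop)).add
          ((integrable_dist_S1 P (by fun_prop) (by fun_prop)).const_mul _)) fun p => ?_
      have e1 := dist_triangle p.1.1 p.1.2 p.2
      have e2 := S1.dist_le_pi p.1.1 p.2
      have e3 := S1.dist_le_pi p.1.1 p.1.2
      have e4 : 0 ≤ dist p.1.2 p.2 := dist_nonneg
      have e5 : 0 ≤ dist p.1.1 p.2 := dist_nonneg
      have e6 : 0 ≤ dist p.1.1 p.1.2 := dist_nonneg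
      simp only
      nlinarith
    · exact integrable_dist_sq_S1 P (by fun_prop) (by fun_prop)
    · exact (integrable_dist_S1 P (by fun_prop) (by fun_prop)).const_mul _

/-- The amount by which the pairing `x ↦ f x`, `y ↦ g y` violates monotonicity at `(x, y)`. -/
def crossing (f g : ℝ → ℝ) (p : ℝ × ℝ) : ℝ := max 0 ((p.2 - p.1) * (f p.1 - g p.2))

theorem crossing_nonneg (f g : ℝ → ℝ) (p : ℝ × ℝ) : 0 ≤ crossing f g p := le_max_left _ _

theorem measurable_crossing {f g : ℝ → ℝ} (hf : Measurable f) (hg : Measurable g) :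
    Measurable (crossing f g) := by
  unfold crossing
  fun_prop

theorem integrable_crossing {m : Measure ℝ} [IsProbabilityMeasure m]
    (hm : ∀ᵐ x ∂m, x ∈ Ico 0 (2 * π)) {f g : ℝ → ℝ} (hf : Measurable f) (hg : Measurable g)
    (hfb : ∀ x, |f x - x| ≤ π) (hgb : ∀ x, |g x - x| ≤ π) :
    Integrable (crossing f g) (m.prod m) := by
  refine Integrable.of_bound (measurable_crossing hf hg).aestronglyMeasurable
    ((2 * π) * (4 * π)) ?_
  filter_upwards [Measure.quasiMeasurePreserving_fst.ae hm,
    Measure.quasiMeasurePreserving_snd.ae hm] with p h1 h2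
  rw [Real.norm_of_nonneg (crossing_nonneg f g p)]
  refine max_le (by positivity) ((le_abs_self _).trans ?_)
  rw [abs_mul]
  have h3 := abs_le.1 (hfb p.1)
  have h4 := abs_le.1 (hgb p.2)
  gcongr
  · rw [abs_le]; constructor <;> linarith [h1.1, h1.2, h2.1, h2.2]
  · rw [abs_le]; constructor <;> linarith [h1.1, h1.2, h2.1, h2.2]

theorem exists_uncrossed_coupling {m : Measure ℝ} [IsProbabilityMeasure m] {f g : ℝ → ℝ}
    (hf : Measurable f) (hg : Measurable g)
    (hfb : ∀ x, |f x - x| ≤ π) (hgb : ∀ x, |g x - x| ≤ π)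
    (hint : Integrable (crossing f g) (m.prod m)) :
    ∃ γ : Measure (S1 × S1), IsProbabilityMeasure γ ∧ γ.map Prod.fst = m.map expc ∧
      γ.map Prod.snd = (2⁻¹ : ENNReal) • (m.map (fun x => expc (f x)) +
        m.map (fun x => expc (g x))) ∧
      (∫ p, dist p.1 p.2 ^ 2 ∂γ) ≤ 2⁻¹ * ((∫ x, dist (expc x) (expc (f x)) ^ 2 ∂m) +
        ∫ x, dist (expc x) (expc (g x)) ^ 2 ∂m) - ∫ p, crossing f g p ∂(m.prod m) := by
  have he := measurable_expc
  set P := m.prod m with hP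
  let A : Set (ℝ × ℝ) := {p | 0 < (p.2 - p.1) * (f p.1 - g p.2)}
  have hA : MeasurableSet A := measurableSet_lt (by fun_prop) (by fun_prop)
  classical
  let a : ℝ × ℝ → ℝ := A.piecewise (fun p => g p.2) (fun p => f p.1)
  let b : ℝ × ℝ → ℝ := A.piecewise (fun p => f p.1) (fun p => g p.2)
  have ha : Measurable a := Measurable.piecewise hA (by fun_prop) (by fun_prop)
  have hb : Measurable b := Measurable.piecewise hA (by fun_prop) (by fun_prop)
  have hU : Measurable fun p : ℝ × ℝ => (expc p.1, expc (a p)) := by fun_prop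
  have hV : Measurable fun p : ℝ × ℝ => (expc p.2, expc (b p)) := by fun_prop
  have : IsProbabilityMeasure (P.map fun p => (expc p.1, expc (a p))) :=
    Measure.isProbabilityMeasure_map hU.aemeasurable
  have : IsProbabilityMeasure (P.map fun p => (expc p.2, expc (b p))) :=
    Measure.isProbabilityMeasure_map hV.aemeasurable
  have hfst : P.map Prod.fst = m := by simp [hP, Measure.map_fst_prod]
  have hsnd : P.map Prod.snd = m := by simp [hP, Measure.map_snd_prod]
  have hd : Measurable fun p : S1 × S1 => dist p.1 p.2 ^ 2 :=
    (measurable_fst.dist measurable_snd).pow_const 2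
  refine ⟨(2⁻¹ : ENNReal) • ((P.map fun p => (expc p.1, expc (a p))) +
    P.map fun p => (expc p.2, expc (b p))), ⟨?_⟩, ?_, ?_, ?_⟩
  · simp only [Measure.smul_apply, Measure.add_apply, measure_univ, smul_eq_mul]
    rw [one_add_one_eq_two, ENNReal.inv_mul_cancel (by simp) (by simp)]
  · have h1 : (P.map fun p => expc p.1) = m.map expc := by
      conv_rhs => rw [← hfst, Measure.map_map he measurable_fst]
      rfl
    have h2 : (P.map fun p => expc p.2) = m.map expc := by
      conv_rhs => rw [← hsnd, Measure.map_map he measurable_snd]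
      rfl
    rw [Measure.map_smul, Measure.map_add _ _ measurable_fst, Measure.map_map measurable_fst hU,
      Measure.map_map measurable_fst hV]
    simp only [Function.comp_def, h1, h2]
    rw [← two_smul ENNReal, smul_smul, ENNReal.inv_mul_cancel (by simp) (by simp), one_smul]
  · rw [Measure.map_smul, Measure.map_add _ _ measurable_snd, Measure.map_map measurable_snd hU,
      Measure.map_map measurable_snd hV]
    congr 1
    have h1 : m.map (fun x => expc (f x)) = P.map fun p => expc (f p.1) := by
      conv_lhs => rw [← hfst, Measure.map_map (by fun_prop) measurable_fst]
      rfl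
    have h2 : m.map (fun x => expc (g x)) = P.map fun p => expc (g p.2) := by
      conv_lhs => rw [← hsnd, Measure.map_map (by fun_prop) measurable_snd]
      rfl
    rw [h1, h2]
    ext s hs
    have key : ∀ {h : ℝ × ℝ → S1}, Measurable h →
        P.map h s = ∫⁻ p, s.indicator 1 (h p) ∂P := fun {h} hh => by
      rw [← lintegral_map (measurable_one.indicator hs) hh, lintegral_indicator_one hs]
    have hi : Measurable (s.indicator (1 : S1 → ENNReal)) := measurable_one.indicator hs
    simp only [Function.comp_def, Measure.add_apply]
    rw [key (by fun_prop), key (by fun_prop), key (by fun_prop), key (by fun_prop),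
      ← lintegral_add_left (by fun_prop), ← lintegral_add_left (by fun_prop)]
    refine lintegral_congr fun p => ?_
    by_cases hp : p ∈ A
    · simp only [a, b, piecewise_eq_of_mem _ _ _ hp, add_comm]
    · simp only [a, b, piecewise_eq_of_notMem _ _ _ hp]
  · have iU := integrable_dist_sq_S1 P (f := fun p => expc p.1) (g := fun p => expc (a p))
      (by fun_prop) (by fun_prop)
    have iV := integrable_dist_sq_S1 P (f := fun p => expc p.2) (g := fun p => expc (b p))
      (by fun_prop) (by fun_prop)
    have iF := integrable_dist_sq_S1 P (f := fun p => expc p.1) (g := fun p => expc (f p.1))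
      (by fun_prop) (by fun_prop)
    have iG := integrable_dist_sq_S1 P (f := fun p => expc p.2) (g := fun p => expc (g p.2))
      (by fun_prop) (by fun_prop)
    have h1 : ∫ x, dist (expc x) (expc (f x)) ^ 2 ∂m =
        ∫ p, dist (expc p.1) (expc (f p.1)) ^ 2 ∂P := by
      conv_lhs => rw [← hfst]
      exact integral_map measurable_fst.aemeasurable
        (((by fun_prop : Measurable expc).dist (by fun_prop)).pow_const 2).aestronglyMeasurable
    have h2 : ∫ x, dist (expc x) (expc (g x)) ^ 2 ∂m =
        ∫ p, dist (expc p.2) (expc (g p.2)) ^ 2 ∂P := by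
      conv_lhs => rw [← hsnd]
      exact integral_map measurable_snd.aemeasurable
        (((by fun_prop : Measurable expc).dist (by fun_prop)).pow_const 2).aestronglyMeasurable
    rw [integral_smul_measure, integral_add_measure
      (integrable_dist_sq_S1 _ measurable_fst measurable_snd)
      (integrable_dist_sq_S1 _ measurable_fst measurable_snd),
      integral_map hU.aemeasurable hd.aestronglyMeasurable,
      integral_map hV.aemeasurable hd.aestronglyMeasurable, h1, h2, ← integral_add iU iV,
      ← integral_add iF iG]
    have hle : ∫ p, (dist (expc p.1) (expc (a p)) ^ 2 + dist (expc p.2) (expc (b p)) ^ 2) ∂P ≤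
        ∫ p, ((dist (expc p.1) (expc (f p.1)) ^ 2 + dist (expc p.2) (expc (g p.2)) ^ 2) -
          2 * crossing f g p) ∂P := by
      refine integral_mono (iU.add iV) ((iF.add iG).sub (hint.const_mul 2)) fun p => ?_
      simp only
      by_cases hp : p ∈ A
      · simp only [a, b, piecewise_eq_of_mem _ _ _ hp]
        rw [dist_expc_of_abs_sub_le (hfb p.1), dist_expc_of_abs_sub_le (hgb p.2), crossing,
          max_eq_right (le_of_lt hp), sq_abs, sq_abs]
        have e1 := pow_le_pow_left₀ dist_nonneg (dist_expc_le p.1 (g p.2)) 2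
        have e2 := pow_le_pow_left₀ dist_nonneg (dist_expc_le p.2 (f p.1)) 2
        rw [sq_abs] at e1 e2
        linarith
      · simp only [a, b, piecewise_eq_of_notMem _ _ _ hp]
        rw [crossing, max_eq_left (not_lt.1 hp)]
        simp
    have iFG : Integrable (fun p : ℝ × ℝ => dist (expc p.1) (expc (f p.1)) ^ 2 +
        dist (expc p.2) (expc (g p.2)) ^ 2) P := iF.add iG
    rw [integral_sub iFG (hint.const_mul 2), integral_const_mul] at hle
    simp only [ENNReal.toReal_inv, ENNReal.toReal_ofNat, smul_eq_mul]
    linarith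

theorem integral_crossing_le {μ ν ρ : Measure S1} [IsProbabilityMeasure μ]
    [IsProbabilityMeasure ν] [IsProbabilityMeasure ρ] {f g : ℝ → ℝ}
    (hf : IsOTMLift μ ρ f) (hg : IsOTMLift μ ν g) :
    ∫ p, crossing f g p ∂((tilde μ).prod (tilde μ)) ≤ 2 * π * √(W2sq ρ ν) := by
  obtain ⟨fmono, fper, fint, fmeas, fmap, fopt⟩ := hf
  obtain ⟨gmono, gper, gint, gmeas, gmap, gopt⟩ := hg
  have : IsProbabilityMeasure (tilde μ) :=
    Measure.isProbabilityMeasure_map measurable_logc.aemeasurable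
  have he := measurable_expc
  have hl := measurable_logc
  have hf := fmono.measurable
  have hg := gmono.measurable
  have fb := abs_sub_le_pi_of_monotone_of_integral_eq_zero fmono fper fint
  have gb := abs_sub_le_pi_of_monotone_of_integral_eq_zero gmono gper gint
  have hI := integrable_crossing (ae_tilde_mem_Ico μ) hf hg fb gb
  obtain ⟨γ, hγ, γ1, γ2, hcost⟩ := exists_uncrossed_coupling hf hg fb gb hI
  have tmap : ∀ {h : ℝ → ℝ}, Measurable h →
      (tilde μ).map (fun x => expc (h x)) = μ.map fun z => expc (h (logc z)) := fun {h} hh => by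
    rw [tilde, Measure.map_map (by fun_prop) hl]
    rfl
  have tint : ∀ {h : ℝ → ℝ}, Measurable h →
      ∫ x, dist (expc x) (expc (h x)) ^ 2 ∂(tilde μ) =
        ∫ z, dist z (expc (h (logc z))) ^ 2 ∂μ := fun {h} hh => by
    rw [tilde, integral_map hl.aemeasurable
      (((by fun_prop : Measurable expc).dist (by fun_prop)).pow_const 2).aestronglyMeasurable]
    simp only [expc_logc]
  rw [tilde_map_expc] at γ1
  rw [tmap hf, tmap hg, fmap, gmap] at γ2
  rw [tint hf, tint hg, fopt, gopt] at hcost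
  set I := ∫ p, crossing f g p ∂((tilde μ).prod (tilde μ)) with hIdef
  have hI0 : 0 ≤ I := integral_nonneg (crossing_nonneg f g)
  have hmain : (I / (2 * π)) ^ 2 ≤ W2sq ρ ν := by
    refine le_W2sq fun η hη η1 η2 => ?_
    set D := ∫ p, dist p.1 p.2 ∂η with hD
    have hdm : Measurable fun p : S1 × S1 => dist p.1 p.2 := measurable_fst.dist measurable_snd
    have step1 : W2sq μ ρ ≤ W2sq μ ν + 2 * π * D := by
      have hgr : Measurable fun z : S1 => (z, expc (g (logc z))) := by fun_prop
      have : IsProbabilityMeasure (μ.map fun z => (z, expc (g (logc z)))) :=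
        Measure.isProbabilityMeasure_map hgr.aemeasurable
      have : IsProbabilityMeasure (η.map Prod.swap) :=
        Measure.isProbabilityMeasure_map measurable_swap.aemeasurable
      have h := W2sq_le_add_of_coupling (μ := μ) (ρ := ν) (σ := ρ)
        (μ.map fun z => (z, expc (g (logc z)))) (η.map Prod.swap)
        (by rw [Measure.map_map measurable_fst hgr]; exact Measure.map_id)
        (by rw [Measure.map_map measurable_snd hgr]; exact gmap)
        (by rw [Measure.map_map measurable_fst measurable_swap]; exact η2)
        (by rw [Measure.map_map measurable_snd measurable_swap]; exact η1)
      rw [integral_map hgr.aemeasurable (hdm.pow_const 2).aestronglyMeasurable,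
        integral_map measurable_swap.aemeasurable hdm.aestronglyMeasurable, gopt] at h
      simpa only [Prod.fst_swap, Prod.snd_swap, dist_comm, hD] using h
    have step2 : W2sq μ ν ≤ (∫ p, dist p.1 p.2 ^ 2 ∂γ) + π * D := by
      have hdg : Measurable fun z : S1 => (z, z) := by fun_prop
      have : IsProbabilityMeasure (ν.map fun z => (z, z)) :=
        Measure.isProbabilityMeasure_map hdg.aemeasurable
      have : IsProbabilityMeasure ((2⁻¹ : ENNReal) • (η + ν.map fun z => (z, z))) := by
        refine ⟨?_⟩
        simp only [Measure.smul_apply, Measure.add_apply, measure_univ, smul_eq_mul]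
        rw [one_add_one_eq_two, ENNReal.inv_mul_cancel (by simp) (by simp)]
      have h := W2sq_le_add_of_coupling (σ := ν) γ ((2⁻¹ : ENNReal) • (η + ν.map fun z => (z, z)))
        γ1 γ2
        (by
          rw [Measure.map_smul, Measure.map_add _ _ measurable_fst,
            Measure.map_map measurable_fst hdg, η1]
          congr 2
          exact Measure.map_id)
        (by
          rw [Measure.map_smul, Measure.map_add _ _ measurable_snd,
            Measure.map_map measurable_snd hdg, η2,
            show ν.map (Prod.snd ∘ fun z => (z, z)) = ν from Measure.map_id,
            ← two_smul ENNReal, smul_smul, ENNReal.inv_mul_cancel (by simp) (by simp), one_smul])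
      rw [integral_smul_measure, integral_add_measure
        (integrable_dist_S1 _ measurable_fst measurable_snd)
        (integrable_dist_S1 _ measurable_fst measurable_snd),
        integral_map hdg.aemeasurable hdm.aestronglyMeasurable] at h
      simp only [dist_self, integral_zero, add_zero, ENNReal.toReal_inv, ENNReal.toReal_ofNat,
        smul_eq_mul] at h
      linarith
    have hID : I / (2 * π) ≤ D := by
      rw [div_le_iff₀ Real.two_pi_pos]
      linarith
    have hD2 : D ^ 2 ≤ ∫ p, dist p.1 p.2 ^ 2 ∂η := by
      have i1 := integrable_dist_S1 η measurable_fst measurable_snd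
      have i2 := integrable_dist_sq_S1 η measurable_fst measurable_snd
      have h0 : ∫ p, (2 * D * dist p.1 p.2 - D ^ 2) ∂η ≤ ∫ p, dist p.1 p.2 ^ 2 ∂η :=
        integral_mono ((i1.const_mul _).sub (integrable_const _)) i2 fun p => by
          have := sq_nonneg (dist p.1 p.2 - D)
          simp only
          linarith
      rw [integral_sub (i1.const_mul _) (integrable_const _), integral_const_mul, ← hD] at h0
      simp only [integral_const, probReal_univ, smul_eq_mul] at h0
      linarith
    exact (pow_le_pow_left₀ (by positivity) hID 2).trans hD2
  have := Real.le_sqrt_of_sq_le hmain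
  rwa [div_le_iff₀ Real.two_pi_pos, mul_comm] at this

theorem measure_eq_zero_of_ae_prod_le {m : Measure ℝ} [IsProbabilityMeasure m]
    (hm : ∀ x, m {x} = 0) {B : Set ℝ}
    (h : ∀ᵐ p ∂(m.prod m), p.1 ∈ B → p.2 ∈ B → p.2 ≤ p.1) : m B = 0 := by
  have hsw : ∀ᵐ p ∂(m.prod m), p.2 ∈ B → p.1 ∈ B → p.1 ≤ p.2 :=
    (Measure.measurePreserving_swap (μ := m) (ν := m)).quasiMeasurePreserving.ae h
  have hdiag : ∀ᵐ p ∂(m.prod m), p.1 ≠ p.2 := by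
    rw [Measure.ae_prod_iff_ae_ae]
    · refine ae_of_all _ fun x => ?_
      rw [ae_iff]
      simpa [eq_comm] using hm x
    · exact (measurableSet_eq_fun measurable_fst measurable_snd).compl
  have hB : (m.prod m) (B ×ˢ B) = 0 := by
    rw [measure_eq_zero_iff_ae_notMem]
    filter_upwards [h, hsw, hdiag] with p h1 h2 h3 hp
    exact h3 (le_antisymm (h2 hp.2 hp.1) (h1 hp.1 hp.2))
  rw [Measure.prod_prod] at hB
  exact mul_self_eq_zero.1 hB

theorem ae_tendsto_of_ae_tendsto_crossing {m : Measure ℝ} [IsProbabilityMeasure m]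
    (hm : ∀ x, m {x} = 0) {f : ℕ → ℝ → ℝ} {g : ℝ → ℝ}
    (h : ∀ᵐ p ∂(m.prod m), Tendsto (fun n => crossing (f n) g p) atTop (𝓝 0)) :
    ∀ᵐ x ∂m, Tendsto (fun n => f n x) atTop (𝓝 (g x)) := by
  have hup : ∀ᵐ x ∂m, ∀ r s : ℚ, r < s → ¬ (g x < r ∧ ∃ᶠ n in atTop, (s : ℝ) < f n x) := by
    simp only [ae_all_iff]
    intro r s hrs
    refine measure_eq_zero_iff_ae_notMem.1
      (measure_eq_zero_of_ae_prod_le (B := {x | g x < r ∧ ∃ᶠ n in atTop, (s : ℝ) < f n x}) hm ?_)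
    filter_upwards [h] with p hp h1 h2
    by_contra! hlt
    have hrs' : (r : ℝ) < s := by exact_mod_cast hrs
    have hpos : 0 < (p.2 - p.1) * ((s : ℝ) - r) := mul_pos (by linarith) (by linarith)
    obtain ⟨n, hn, hn'⟩ := (h1.2.and_eventually (hp.eventually_lt_const hpos)).exists
    refine absurd hn' (not_lt.2 (le_max_of_le_right ?_))
    have := h2.1
    gcongr
  have hlo : ∀ᵐ x ∂m, ∀ r s : ℚ, r < s → ¬ ((s : ℝ) < g x ∧ ∃ᶠ n in atTop, f n x < r) := by
    simp only [ae_all_iff]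
    intro r s hrs
    refine measure_eq_zero_iff_ae_notMem.1
      (measure_eq_zero_of_ae_prod_le (B := {x | (s : ℝ) < g x ∧ ∃ᶠ n in atTop, f n x < r}) hm ?_)
    filter_upwards [(Measure.measurePreserving_swap (μ := m)
      (ν := m)).quasiMeasurePreserving.ae h] with p hp h1 h2
    by_contra! hlt
    have hrs' : (r : ℝ) < s := by exact_mod_cast hrs
    have hpos : 0 < (p.2 - p.1) * ((s : ℝ) - r) := mul_pos (by linarith) (by linarith)
    obtain ⟨n, hn, hn'⟩ := (h2.2.and_eventually (hp.eventually_lt_const hpos)).exists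
    refine absurd hn' (not_lt.2 (le_max_of_le_right ?_))
    have := h1.1
    simp only [Prod.fst_swap, Prod.snd_swap]
    nlinarith
  filter_upwards [hup, hlo] with x h1 h2
  refine tendsto_order.2 ⟨fun c hc => ?_, fun c hc => ?_⟩
  · obtain ⟨s, hs, hs'⟩ := exists_rat_btwn hc
    obtain ⟨r, hr, hr'⟩ := exists_rat_btwn hs
    have := not_and.1 (h2 r s (by exact_mod_cast hr')) hs'
    filter_upwards [not_frequently.1 this] with n hn
    linarith [not_lt.1 hn]
  · obtain ⟨r, hr, hr'⟩ := exists_rat_btwn hc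
    obtain ⟨s, hs, hs'⟩ := exists_rat_btwn hr'
    have := not_and.1 (h1 r s (by exact_mod_cast hs)) hr
    filter_upwards [not_frequently.1 this] with n hn
    linarith [not_lt.1 hn]

/-- Sequential continuity of the logarithmic map: if `W₂(ν_n, ν) → 0` then
the lifts of the optimal transport maps from `μ` converge in `L²(μ̃)`. -/
theorem stmt5 (μ : Measure S1) [IsProbabilityMeasure μ] (hac : μ ≪ volume)
    (ν : Measure S1) [IsProbabilityMeasure ν]
    (νs : ℕ → Measure S1) [∀ n, IsProbabilityMeasure (νs n)]
    (hconv : Tendsto (fun n => Real.sqrt (W2sq (νs n) ν)) atTop (𝓝 0))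
    (Tn : ℕ → ℝ → ℝ) (hTn : ∀ n, IsOTMLift μ (νs n) (Tn n))
    (Tt : ℝ → ℝ) (hTt : IsOTMLift μ ν Tt) :
    Tendsto (fun n => ∫ x, (Tn n x - Tt x) ^ 2 ∂(tilde μ)) atTop (𝓝 0) := by
  have : IsProbabilityMeasure (tilde μ) :=
    Measure.isProbabilityMeasure_map measurable_logc.aemeasurable
  have bound : ∀ {ρ : Measure S1} {T : ℝ → ℝ}, IsOTMLift μ ρ T → ∀ x, |T x - x| ≤ π :=
    fun hT => abs_sub_le_pi_of_monotone_of_integral_eq_zero hT.1 hT.2.1 hT.2.2.1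
  have hI : ∀ n, Integrable (crossing (Tn n) Tt) ((tilde μ).prod (tilde μ)) := fun n =>
    integrable_crossing (ae_tilde_mem_Ico μ) (hTn n).1.measurable hTt.1.measurable
      (bound (hTn n)) (bound hTt)
  have hcross : Tendsto (fun n => ∫ p, crossing (Tn n) Tt p ∂((tilde μ).prod (tilde μ)))
      atTop (𝓝 0) := by
    refine squeeze_zero (fun n => integral_nonneg (crossing_nonneg _ _))
      (fun n => integral_crossing_le (hTn n) hTt) ?_
    simpa using hconv.const_mul (2 * π)
  have hmeas : TendstoInMeasure ((tilde μ).prod (tilde μ)) (fun n => crossing (Tn n) Tt)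
      atTop 0 := by
    refine tendstoInMeasure_of_tendsto_eLpNorm one_ne_zero
      (fun n => (hI n).aestronglyMeasurable) aestronglyMeasurable_zero ?_
    have h := (ENNReal.continuous_ofReal.tendsto 0).comp hcross
    rw [ENNReal.ofReal_zero] at h
    refine h.congr fun n => ?_
    rw [Function.comp_apply, sub_zero, eLpNorm_one_eq_lintegral_enorm,
      ← ofReal_integral_norm_eq_lintegral_enorm (hI n)]
    simp only [Real.norm_of_nonneg (crossing_nonneg _ _ _)]
  refine tendsto_of_subseq_tendsto fun ns hns => ?_
  obtain ⟨ms, -, hms⟩ := TendstoInMeasure.exists_seq_tendsto_ae (hmeas.comp hns)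
  refine ⟨ms, ?_⟩
  have hae := ae_tendsto_of_ae_tendsto_crossing (tilde_singleton hac)
    (f := fun k => Tn (ns (ms k))) (g := Tt) hms
  rw [← integral_zero ℝ ℝ (μ := tilde μ)]
  refine tendsto_integral_of_dominated_convergence (fun _ => (2 * π) ^ 2)
    (fun k => (((hTn _).1.measurable.sub hTt.1.measurable).pow_const 2).aestronglyMeasurable)
    (integrable_const _) (fun k => ae_of_all _ fun x => ?_) ?_
  · have h1 := abs_le.1 (bound (hTn (ns (ms k))) x)
    have h2 := abs_le.1 (bound hTt x)
    rw [Real.norm_of_nonneg (by positivity), ← sq_abs]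
    gcongr
    rw [abs_le]
    constructor <;> linarith
  · filter_upwards [hae] with x hx
    simpa using (hx.sub_const (Tt x)).pow 2

end
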